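/- Let t0 < t1 and let V : [t0,t1] → ℝ³ be a C^∞ curve with V''(t) = V'(t) × V(t) + C for all t (C ∈ ℝ³ constant), and suppose V''(t) ≠ 0 and V'''(t) ≠ 0 for all t ∈ [t0,t1]. Let c := ‖V''(t0)‖² (so c = ‖V''(t)‖² for all t, by constancy of ‖V''‖), and define φ(t) := √c · ∫_{t0}^{t} (c − ⟨C, V''(s)⟩)/‖V'''(s)‖² ds. For r ∈ ℝ let R_r be the 3×3 matrix with rows (cos r, sin r, 0), (−sin r, cos r, 0), (0,0,1), and for each t let S(t) be the 3×3 matrix whose rows are V'''(t)/‖V'''(t)‖, (V''(t) × V'''(t))/(‖V''(t)‖·‖V'''(t)‖), and V''(t)/‖V''(t)‖ (note ⟨V''(t), V'''(t)⟩ = 0, so these rows are orthonormal). Put y(t) := R_{φ(t)} · S(t). Then y(t) ∈ SO(3) and y'(t) = y(t) · M(V(t)) for all t ∈ [t0,t1], where M(v) denotes the skew-symmetric 3×3 matrix determined by M(v)w = v × w for all w ∈ ℝ³. Consequently, for any x₀ ∈ SO(3), the curve x(t) := x₀ · y(t0)ᵀ · y(t) is the unique solution of x'(t) = x(t)·M(V(t))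 with x(t0) = x₀, i.e. the Riemannian cubic in SO(3) with left Lie reduction V passing through x₀ at t0. -/

import Mathlib

noncomputable section
open scoped RealInnerProductSpace Matrix

attribute [local instance] Matrix.normedAddCommGroup Matrix.normedSpace

/-- `ℝ³` with the Euclidean inner product. -/
abbrev E3 : Type := EuclideanSpace ℝ (Fin 3)

/-- The cross product on `ℝ³`; with `⁅u,v⁆ := cross u v`, `ℝ³` is the Lie algebra `so(3)`. -/
def cross (u v : E3) : E3 :=
  (WithLp.equiv 2 (Fin 3 → ℝ)).symm
    ![u 1 * v 2 - u 2 * v 1, u 2 * v 0 - u 0 * v 2, u 0 * v 1 - u 1 * v 0]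

/-- The skew-symmetric matrix `M(v)` with `M(v)w = v × w`, identifying `so(3)` with `ℝ³`. -/
def Mskew (v : E3) : Matrix (Fin 3) (Fin 3) ℝ :=
  !![0, -v 2, v 1; v 2, 0, -v 0; -v 1, v 0, 0]

/-- Clockwise rotation by `r` in the first two coordinates. -/
def Rrot (r : ℝ) : Matrix (Fin 3) (Fin 3) ℝ :=
  !![Real.cos r, Real.sin r, 0; -Real.sin r, Real.cos r, 0; 0, 0, 1]

lemma cross_0 (u v : E3) : cross u v 0 = u 1 * v 2 - u 2 * v 1 := rfl
lemma cross_1 (u v : E3) : cross u v 1 = u 2 * v 0 - u 0 * v 2 := rfl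
lemma cross_2 (u v : E3) : cross u v 2 = u 0 * v 1 - u 1 * v 0 := rfl

lemma hasDeriv_mat {f : ℝ → Matrix (Fin 3) (Fin 3) ℝ} {f' : Matrix (Fin 3) (Fin 3) ℝ}
    {s : Set ℝ} {t : ℝ} :
    HasDerivWithinAt f f' s t ↔ ∀ i j, HasDerivWithinAt (fun x => f x i j) (f' i j) s t := by
  constructor
  · intro h i
    exact hasDerivWithinAt_pi.1 (hasDerivWithinAt_pi.1 h i)
  · intro h
    exact hasDerivWithinAt_pi.2 fun i => hasDerivWithinAt_pi.2 (h i)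

lemma hasDeriv_mat_mul {f g : ℝ → Matrix (Fin 3) (Fin 3) ℝ} {f' g' : Matrix (Fin 3) (Fin 3) ℝ}
    {s : Set ℝ} {t : ℝ} (hf : HasDerivWithinAt f f' s t) (hg : HasDerivWithinAt g g' s t) :
    HasDerivWithinAt (fun x => f x * g x) (f' * g t + f t * g') s t := by
  rw [hasDeriv_mat] at *
  intro i j
  simp only [Matrix.mul_apply, Matrix.add_apply, ← Finset.sum_add_distrib]
  exact HasDerivWithinAt.fun_sum fun k _ => (hf i k).mul (hg k j)

lemma hasDeriv_mat_transpose {f : ℝ → Matrix (Fin 3) (Fin 3) ℝ} {f' : Matrix (Fin 3) (Fin 3) ℝ}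
    {s : Set ℝ} {t : ℝ} (hf : HasDerivWithinAt f f' s t) :
    HasDerivWithinAt (fun x => (f x)ᵀ) (f'ᵀ) s t := by
  rw [hasDeriv_mat] at *
  intro i j
  exact hf j i

lemma hasDeriv_coord {f : ℝ → E3} {f' : E3} {s : Set ℝ} {t : ℝ}
    (h : HasDerivWithinAt f f' s t) (i : Fin 3) :
    HasDerivWithinAt (fun x => f x i) (f' i) s t :=
  (EuclideanSpace.proj i : E3 →L[ℝ] ℝ).hasFDerivAt.comp_hasDerivWithinAt t h

lemma hasDeriv_of_coord {f : ℝ → E3} {f' : E3} {s : Set ℝ} {t : ℝ}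
    (h : ∀ i, HasDerivWithinAt (fun x => f x i) (f' i) s t) :
    HasDerivWithinAt f f' s t := by
  have h1 : HasDerivWithinAt (fun x => WithLp.ofLp (f x)) (WithLp.ofLp f') s t :=
    hasDerivWithinAt_pi.2 h
  exact (EuclideanSpace.equiv (Fin 3) ℝ).symm.toContinuousLinearMap.hasFDerivAt.comp_hasDerivWithinAt
    t h1

lemma hasDeriv_cross {f g : ℝ → E3} {f' g' : E3} {s : Set ℝ} {t : ℝ}
    (hf : HasDerivWithinAt f f' s t) (hg : HasDerivWithinAt g g' s t) :
    HasDerivWithinAt (fun x => cross (f x) (g x)) (cross f' (g t) + cross (f t) g') s t := by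
  have a := hasDeriv_coord hf
  have b := hasDeriv_coord hg
  apply hasDeriv_of_coord
  intro i
  fin_cases i
  · refine (((a 1).mul (b 2)).sub ((a 2).mul (b 1))).congr_deriv ?_
    change _ = cross f' (g t) 0 + cross (f t) g' 0
    simp only [cross_0]; ring
  · refine (((a 2).mul (b 0)).sub ((a 0).mul (b 2))).congr_deriv ?_
    change _ = cross f' (g t) 1 + cross (f t) g' 1
    simp only [cross_1]; ring
  · refine (((a 0).mul (b 1)).sub ((a 1).mul (b 0))).congr_deriv ?_
    change _ = cross f' (g t) 2 + cross (f t) g' 2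
    simp only [cross_2]; ring

lemma normsq_E3 (u : E3) : ‖u‖ ^ 2 = u 0 ^ 2 + u 1 ^ 2 + u 2 ^ 2 := by
  simp [EuclideanSpace.norm_sq_eq, Fin.sum_univ_three]

lemma inner_E3 (u v : E3) : ⟪u, v⟫ = u 0 * v 0 + u 1 * v 1 + u 2 * v 2 := by
  simp [PiLp.inner_apply, Fin.sum_univ_three, mul_comm]

lemma hasDeriv_norm {f : ℝ → E3} {f' : E3} {s : Set ℝ} {t : ℝ}
    (hf : HasDerivWithinAt f f' s t) (h0 : f t ≠ 0) :
    HasDerivWithinAt (fun x => ‖f x‖) (⟪f t, f'⟫ / ‖f t‖) s t := by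
  have h1 := hf.norm_sq
  have h2 := h1.sqrt (by simpa using h0)
  simp only [Real.sqrt_sq (norm_nonneg _)] at h2
  convert h2 using 1
  field_simp

def Jmat : Matrix (Fin 3) (Fin 3) ℝ := !![0, 1, 0; -1, 0, 0; 0, 0, 0]

/-- the frame built from `U`, `W` -/
def Sfr (U W : E3) : Matrix (Fin 3) (Fin 3) ℝ :=
  Matrix.of ![fun j => U j / ‖U‖, fun j => cross W U j / (‖W‖ * ‖U‖), fun j => W j / ‖W‖]

lemma Sfr_eq (U W : E3) {n r : ℝ} (hn : ‖U‖ = n) (hr : ‖W‖ = r) : Sfr U W =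
    !![U 0 / n, U 1 / n, U 2 / n;
      (W 1 * U 2 - W 2 * U 1) / (r * n), (W 2 * U 0 - W 0 * U 2) / (r * n),
        (W 0 * U 1 - W 1 * U 0) / (r * n);
      W 0 / r, W 1 / r, W 2 / r] := by
  subst hn hr
  ext i j
  fin_cases i <;> fin_cases j <;> rfl

lemma row1_aux {n r X u D T q K : ℝ} (hn : 0 < n) (hr : 0 < r)
    (h : X * n ^ 2 - u * D = n ^ 2 * T + q * K) :
    (X * n - u * (D / n)) / n ^ 2 = T / n - (-r * q / n ^ 2) * (K / (r * n)) := by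
  field_simp
  linear_combination h

lemma row2_aux {n r X u D T q K : ℝ} (hn : 0 < n) (hr : 0 < r)
    (h : X * n ^ 2 - K * D = n ^ 2 * T - r ^ 2 * q * u) :
    (X * (r * n) - K * (r * (D / n))) / (r * n) ^ 2
      = T / (r * n) + (-r * q / n ^ 2) * (u / n) := by
  field_simp
  linear_combination h

lemma hasDeriv_S {U W : ℝ → E3} {V A : E3} {s : Set ℝ} {t r p : ℝ} (hr : 0 < r) (hts : t ∈ s)
    (hWr : ∀ x ∈ s, ‖W x‖ = r)
    (hW : HasDerivWithinAt W (U t) s t)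
    (hU : HasDerivWithinAt U (cross (U t) V + cross (W t) A) s t)
    (hUe : U t = cross (W t) V) (hU0 : U t ≠ 0)
    (hp : p = - r * ⟪A, U t⟫ / ‖U t‖ ^ 2) :
    HasDerivWithinAt (fun x => Sfr (U x) (W x)) (Sfr (U t) (W t) * Mskew V
      - p • (Jmat * Sfr (U t) (W t))) s t := by
  have hn : 0 < ‖U t‖ := norm_pos_iff.2 hU0
  have hN := hasDeriv_norm hU hU0
  have hn2 := normsq_E3 (U t)
  have hr2 := normsq_E3 (W t)
  rw [hWr t hts] at hr2
  have a := hasDeriv_coord hW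
  have b := hasDeriv_coord hU
  have k := hasDeriv_coord (hasDeriv_cross hW hU)
  have hWU : W t 0 * U t 0 + W t 1 * U t 1 + W t 2 * U t 2 = 0 := by
    rw [hUe, cross_0, cross_1, cross_2]; ring
  have hUV : V 0 * U t 0 + V 1 * U t 1 + V 2 * U t 2 = 0 := by
    rw [hUe, cross_0, cross_1, cross_2]; ring
  have e0 : U t 0 = W t 1 * V 2 - W t 2 * V 1 := by rw [hUe, cross_0]
  have e1 : U t 1 = W t 2 * V 0 - W t 0 * V 2 := by rw [hUe, cross_1]
  have e2 : U t 2 = W t 0 * V 1 - W t 1 * V 0 := by rw [hUe, cross_2]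
  have key : HasDerivWithinAt (fun x => (Matrix.of ![fun j => U x j / ‖U x‖,
      fun j => cross (W x) (U x) j / (r * ‖U x‖), fun j => W x j / r] : Matrix (Fin 3) (Fin 3) ℝ))
      (Sfr (U t) (W t) * Mskew V - p • (Jmat * Sfr (U t) (W t))) s t := by
    rw [Sfr_eq (U t) (W t) rfl (hWr t hts), hasDeriv_mat]
    rw [inner_E3] at hp hN
    intro i j
    fin_cases i
    · refine ((b j).div hN hn.ne').congr_deriv ?_
      generalize ‖U t‖ = n at *
      simp only [PiLp.add_apply, cross_0, cross_1, cross_2]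
      fin_cases j
      · refine (row1_aux (T := (U t 1 * V 2 - U t 2 * V 1)) (q := (A 0 * U t 0 + A 1 * U t 1 + A 2 * U t 2)) (K := (W t 1 * U t 2 - W t 2 * U t 1)) hn hr ?_).trans ?_
        · simp [cross_0, cross_1, cross_2]
          linear_combination (W t 1 * A 2 - W t 2 * A 1) * hn2 + (U t 1 * A 2 - U t 2 * A 1) * hWU
        · simp [Jmat, Mskew, Matrix.mul_apply, Fin.sum_univ_three, cross_0, cross_1, cross_2, hp]
          ring
      · refine (row1_aux (T := (U t 2 * V 0 - U t 0 * V 2)) (q := (A 0 * U t 0 + A 1 * U t 1 + A 2 * U t 2)) (K := (W t 2 * U t 0 - W t 0 * U t 2)) hn hr ?_).trans ?_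
        · simp [cross_0, cross_1, cross_2]
          linear_combination (W t 2 * A 0 - W t 0 * A 2) * hn2 + (U t 2 * A 0 - U t 0 * A 2) * hWU
        · simp [Jmat, Mskew, Matrix.mul_apply, Fin.sum_univ_three, cross_0, cross_1, cross_2, hp]
          ring
      · refine (row1_aux (T := (U t 0 * V 1 - U t 1 * V 0)) (q := (A 0 * U t 0 + A 1 * U t 1 + A 2 * U t 2)) (K := (W t 0 * U t 1 - W t 1 * U t 0)) hn hr ?_).trans ?_
        · simp [cross_0, cross_1, cross_2]
          linear_combination (W t 0 * A 1 - W t 1 * A 0) * hn2 + (U t 0 * A 1 - U t 1 * A 0) * hWU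
        · simp [Jmat, Mskew, Matrix.mul_apply, Fin.sum_univ_three, cross_0, cross_1, cross_2, hp]
          ring
    · refine ((k j).div (hN.const_mul r) (mul_pos hr hn).ne').congr_deriv ?_
      generalize ‖U t‖ = n at *
      simp only [PiLp.add_apply, cross_0, cross_1, cross_2]
      fin_cases j
      · refine (row2_aux (u := U t 0) (T := ((W t 2 * U t 0 - W t 0 * U t 2) * V 2 - (W t 0 * U t 1 - W t 1 * U t 0) * V 1)) (q := (A 0 * U t 0 + A 1 * U t 1 + A 2 * U t 2)) hn hr ?_).trans ?_
        · simp [cross_0, cross_1, cross_2]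
          linear_combination n ^ 2 * (-V 0 * hWU + W t 0 * hUV) + (W t 1 * (W t 0 * A 1 - W t 1 * A 0) - W t 2 * (W t 2 * A 0 - W t 0 * A 2)) * hn2
            + ((A 0 * U t 0 + A 1 * U t 1 + A 2 * U t 2) * W t 0 + (W t 1 * (U t 0 * A 1 - U t 1 * A 0) - W t 2 * (U t 2 * A 0 - U t 0 * A 2))) * hWU + (A 0 * U t 0 + A 1 * U t 1 + A 2 * U t 2) * U t 0 * hr2
        · simp [Jmat, Mskew, Matrix.mul_apply, Fin.sum_univ_three, cross_0, cross_1, cross_2, hp]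
          ring
      · refine (row2_aux (u := U t 1) (T := ((W t 0 * U t 1 - W t 1 * U t 0) * V 0 - (W t 1 * U t 2 - W t 2 * U t 1) * V 2)) (q := (A 0 * U t 0 + A 1 * U t 1 + A 2 * U t 2)) hn hr ?_).trans ?_
        · simp [cross_0, cross_1, cross_2]
          linear_combination n ^ 2 * (-V 1 * hWU + W t 1 * hUV) + (W t 2 * (W t 1 * A 2 - W t 2 * A 1) - W t 0 * (W t 0 * A 1 - W t 1 * A 0)) * hn2
            + ((A 0 * U t 0 + A 1 * U t 1 + A 2 * U t 2) * W t 1 + (W t 2 * (U t 1 * A 2 - U t 2 * A 1) - W t 0 * (U t 0 * A 1 - U t 1 * A 0))) * hWU + (A 0 * U t 0 + A 1 * U t 1 + A 2 * U t 2) * U t 1 * hr2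
        · simp [Jmat, Mskew, Matrix.mul_apply, Fin.sum_univ_three, cross_0, cross_1, cross_2, hp]
          ring
      · refine (row2_aux (u := U t 2) (T := ((W t 1 * U t 2 - W t 2 * U t 1) * V 1 - (W t 2 * U t 0 - W t 0 * U t 2) * V 0)) (q := (A 0 * U t 0 + A 1 * U t 1 + A 2 * U t 2)) hn hr ?_).trans ?_
        · simp [cross_0, cross_1, cross_2]
          linear_combination n ^ 2 * (-V 2 * hWU + W t 2 * hUV) + (W t 0 * (W t 2 * A 0 - W t 0 * A 2) - W t 1 * (W t 1 * A 2 - W t 2 * A 1)) * hn2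
            + ((A 0 * U t 0 + A 1 * U t 1 + A 2 * U t 2) * W t 2 + (W t 0 * (U t 2 * A 0 - U t 0 * A 2) - W t 1 * (U t 1 * A 2 - U t 2 * A 1))) * hWU + (A 0 * U t 0 + A 1 * U t 1 + A 2 * U t 2) * U t 2 * hr2
        · simp [Jmat, Mskew, Matrix.mul_apply, Fin.sum_univ_three, cross_0, cross_1, cross_2, hp]
          ring
    · refine ((a j).div_const r).congr_deriv ?_
      fin_cases j <;> simp [Jmat, Mskew, Matrix.mul_apply, Fin.sum_univ_three]
      · rw [e0]; ring
      · rw [e1]; ring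
      · rw [e2]; ring
  refine key.congr_of_mem (fun x hx => ?_) hts
  simp only [Sfr, hWr x hx]

lemma hasDeriv_R {φ : ℝ → ℝ} {p : ℝ} {s : Set ℝ} {t : ℝ} (h : HasDerivWithinAt φ p s t) :
    HasDerivWithinAt (fun x => Rrot (φ x)) (p • (Rrot (φ t) * Jmat)) s t := by
  have h1 := h.cos
  have h2 := h.sin
  have h3 := h2.fun_neg
  rw [hasDeriv_mat]
  intro i j
  fin_cases i <;> fin_cases j <;>
    simp [Rrot, Jmat, Matrix.mul_apply, Fin.sum_univ_three, hasDerivWithinAt_const]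
  · exact h1.congr_deriv (by ring)
  · exact h2.congr_deriv (by ring)
  · exact h3.congr_deriv (by ring)
  · exact h1.congr_deriv (by ring)

lemma S_mem {U W : E3} (hU : U ≠ 0) (hW : W ≠ 0)
    (hWU : W 0 * U 0 + W 1 * U 1 + W 2 * U 2 = 0) :
    Sfr U W ∈ Matrix.specialOrthogonalGroup (Fin 3) ℝ := by
  have hn : 0 < ‖U‖ := norm_pos_iff.2 hU
  have hr : 0 < ‖W‖ := norm_pos_iff.2 hW
  have hn2 := normsq_E3 U
  have hr2 := normsq_E3 W
  rw [Sfr_eq U W rfl rfl]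
  generalize ‖U‖ = n at *
  generalize ‖W‖ = r at *
  have hK : (W 1 * U 2 - W 2 * U 1) ^ 2 + (W 2 * U 0 - W 0 * U 2) ^ 2
      + (W 0 * U 1 - W 1 * U 0) ^ 2 = r ^ 2 * n ^ 2 := by
    rw [hn2, hr2]
    linear_combination (-(W 0 * U 0 + W 1 * U 1 + W 2 * U 2)) * hWU
  rw [Matrix.mem_specialOrthogonalGroup_iff, Matrix.mem_orthogonalGroup_iff]
  constructor
  · ext i j
    fin_cases i <;> fin_cases j <;>
      simp [Matrix.mul_apply, Fin.sum_univ_three] <;>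
      field_simp
    · linear_combination -hn2
    · ring
    · linear_combination hWU
    · ring
    · linear_combination hK
    · ring
    · linear_combination hWU
    · ring
    · linear_combination -hr2
  · rw [Matrix.det_fin_three]
    simp
    field_simp
    linear_combination hK

lemma R_mem (r : ℝ) : Rrot r ∈ Matrix.specialOrthogonalGroup (Fin 3) ℝ := by
  rw [Matrix.mem_specialOrthogonalGroup_iff, Matrix.mem_orthogonalGroup_iff]
  have := Real.sin_sq_add_cos_sq r
  constructor
  · ext i j
    fin_cases i <;> fin_cases j <;>
      simp [Rrot, Matrix.mul_apply, Fin.sum_univ_three] <;> linarith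
  · rw [Matrix.det_fin_three]
    simp [Rrot]; linarith

lemma Rrot_comm (r : ℝ) : Rrot r * Jmat = Jmat * Rrot r := by
  ext i j
  fin_cases i <;> fin_cases j <;> simp [Rrot, Jmat, Matrix.mul_apply, Fin.sum_univ_three]

lemma Mskew_transpose (v : E3) : (Mskew v)ᵀ = - Mskew v := by
  ext i j
  fin_cases i <;> fin_cases j <;> simp [Mskew]

/-- The paper's Lemma 1: for a Lie quadratic `V` on `[t0,t1]` with `V'' ≠ 0` and `V''' ≠ 0`,
the curve `y(t) := R_{φ(t)}·S(t)` lies in `SO(3)` and satisfies `y' = y·M(V)`; consequently,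
for any `x₀ ∈ SO(3)`, `x(t) := x₀·y(t0)ᵀ·y(t)` is the unique solution of `x' = x·M(V)` with
`x(t0) = x₀`, i.e. the Riemannian cubic in `SO(3)` with left Lie reduction `V` through `x₀`. -/
theorem stmt_17 (t0 t1 : ℝ) (ht : t0 < t1) (V : ℝ → E3) (C : E3)
    (hV : ContDiffOn ℝ (⊤ : ℕ∞) V (Set.Icc t0 t1))
    (hLQ : ∀ t ∈ Set.Icc t0 t1,
        iteratedDerivWithin 2 V (Set.Icc t0 t1) t =
          cross (iteratedDerivWithin 1 V (Set.Icc t0 t1) t) (V t) + C)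
    (hV2 : ∀ t ∈ Set.Icc t0 t1, iteratedDerivWithin 2 V (Set.Icc t0 t1) t ≠ 0)
    (hV3 : ∀ t ∈ Set.Icc t0 t1, iteratedDerivWithin 3 V (Set.Icc t0 t1) t ≠ 0)
    (c : ℝ) (hc : c = ‖iteratedDerivWithin 2 V (Set.Icc t0 t1) t0‖ ^ 2)
    (φ : ℝ → ℝ)
    (hφ : ∀ t : ℝ, φ t = Real.sqrt c *
        ∫ s in t0..t,
          (c - ⟪C, iteratedDerivWithin 2 V (Set.Icc t0 t1) s⟫) /
            ‖iteratedDerivWithin 3 V (Set.Icc t0 t1) s‖ ^ 2)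
    (S : ℝ → Matrix (Fin 3) (Fin 3) ℝ)
    (hS : ∀ t : ℝ, S t = Matrix.of
        ![fun j => iteratedDerivWithin 3 V (Set.Icc t0 t1) t j /
            ‖iteratedDerivWithin 3 V (Set.Icc t0 t1) t‖,
          fun j => cross (iteratedDerivWithin 2 V (Set.Icc t0 t1) t)
              (iteratedDerivWithin 3 V (Set.Icc t0 t1) t) j /
            (‖iteratedDerivWithin 2 V (Set.Icc t0 t1) t‖ *
              ‖iteratedDerivWithin 3 V (Set.Icc t0 t1) t‖),
          fun j => iteratedDerivWithin 2 V (Set.Icc t0 t1) t j /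
            ‖iteratedDerivWithin 2 V (Set.Icc t0 t1) t‖])
    (y : ℝ → Matrix (Fin 3) (Fin 3) ℝ) (hy : ∀ t : ℝ, y t = Rrot (φ t) * S t) :
    (∀ t ∈ Set.Icc t0 t1,
        y t ∈ Matrix.specialOrthogonalGroup (Fin 3) ℝ ∧
          HasDerivWithinAt y (y t * Mskew (V t)) (Set.Icc t0 t1) t) ∧
      ∀ x₀ ∈ Matrix.specialOrthogonalGroup (Fin 3) ℝ,
        (∀ t ∈ Set.Icc t0 t1,
            HasDerivWithinAt (fun s => x₀ * (y t0)ᵀ * y s)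
              (x₀ * (y t0)ᵀ * y t * Mskew (V t)) (Set.Icc t0 t1) t) ∧
          x₀ * (y t0)ᵀ * y t0 = x₀ ∧
          ∀ z : ℝ → Matrix (Fin 3) (Fin 3) ℝ, z t0 = x₀ →
            (∀ t ∈ Set.Icc t0 t1,
                HasDerivWithinAt z (z t * Mskew (V t)) (Set.Icc t0 t1) t) →
            ∀ t ∈ Set.Icc t0 t1, z t = x₀ * (y t0)ᵀ * y t := by
  set s := Set.Icc t0 t1 with hs
  have hu : UniqueDiffOn ℝ s := uniqueDiffOn_Icc ht
  have ht0 : t0 ∈ s := Set.left_mem_Icc.2 ht.le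
  have hD : ∀ n : ℕ, ∀ t ∈ s, HasDerivWithinAt (iteratedDerivWithin n V s)
      (iteratedDerivWithin (n + 1) V s t) s t := by
    intro n t hts
    rw [iteratedDerivWithin_succ]
    exact (hV.differentiableOn_iteratedDerivWithin (by exact_mod_cast WithTop.coe_lt_top n) hu
      t hts).hasDerivWithinAt
  have hD0 : ∀ t ∈ s, HasDerivWithinAt V (iteratedDerivWithin 1 V s t) s t := by
    intro t hts
    have h := hD 0 t hts
    rwa [iteratedDerivWithin_zero, zero_add] at h
  have hD1 := hD 1
  have hD2 := hD 2
  have hD3 := hD 3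
  simp only [Nat.reduceAdd] at hD1 hD2 hD3
  clear hD
  generalize iteratedDerivWithin 1 V s = A at *
  generalize iteratedDerivWithin 2 V s = W at *
  generalize iteratedDerivWithin 3 V s = U at *
  generalize iteratedDerivWithin 4 V s = Z at *
  have hUe : ∀ t ∈ s, U t = cross (W t) (V t) := by
    intro t hts
    have h1 := ((hasDeriv_cross (hD1 t hts) (hD0 t hts)).add_const C).congr_of_mem hLQ hts
    have h2 := (hu t hts).eq_deriv s (hD2 t hts) h1
    rw [h2]
    ext i
    fin_cases i <;> simp [cross_0, cross_1, cross_2] <;> ring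
  have hU' : ∀ t ∈ s, HasDerivWithinAt U (cross (U t) (V t) + cross (W t) (A t)) s t := by
    intro t hts
    exact (hasDeriv_cross (hD2 t hts) (hD0 t hts)).congr_of_mem hUe hts
  have hWU : ∀ t ∈ s, W t 0 * U t 0 + W t 1 * U t 1 + W t 2 * U t 2 = 0 := by
    intro t hts
    rw [hUe t hts, cross_0, cross_1, cross_2]; ring
  have hWc : ∀ t ∈ s, ‖W t‖ ^ 2 = c := by
    have h1 : ∀ t ∈ s, HasDerivWithinAt (fun x => ‖W x‖ ^ 2) 0 s t := by
      intro t hts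
      refine (hD2 t hts).norm_sq.congr_deriv ?_
      rw [inner_E3, hWU t hts, mul_zero]
    intro t hts
    rw [hc]
    exact constant_of_derivWithin_zero (fun x hx => (h1 x hx).differentiableWithinAt)
      (fun x hx => (h1 x (Set.Ico_subset_Icc_self hx)).derivWithin
        (hu x (Set.Ico_subset_Icc_self hx))) t hts
  have hWr : ∀ t ∈ s, ‖W t‖ = Real.sqrt c := by
    intro t hts
    rw [← hWc t hts, Real.sqrt_sq (norm_nonneg _)]
  have hr : 0 < Real.sqrt c := by
    rw [← hWr t0 ht0]; exact norm_pos_iff.2 (hV2 t0 ht0)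
  have hWcont : ContinuousOn W s := fun t hts => (hD2 t hts).continuousWithinAt
  have hUcont : ContinuousOn U s := fun t hts => (hD3 t hts).continuousWithinAt
  have hFc : ContinuousOn (fun x => (c - ⟪C, W x⟫) / ‖U x‖ ^ 2) s := by
    refine ContinuousOn.div (continuousOn_const.sub (continuousOn_const.inner hWcont))
      (hUcont.norm.pow 2) ?_
    intro x hx
    exact pow_ne_zero 2 (norm_ne_zero_iff.2 (hV3 x hx))
  have hφ' : ∀ t ∈ s, HasDerivWithinAt φ (Real.sqrt c * ((c - ⟪C, W t⟫) / ‖U t‖ ^ 2)) s t := by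
    intro t hts
    have : Fact (t ∈ Set.Icc t0 t1) := ⟨hts⟩
    have h1 : IntervalIntegrable (fun x => (c - ⟪C, W x⟫) / ‖U x‖ ^ 2) MeasureTheory.volume t0 t := by
      apply ContinuousOn.intervalIntegrable
      rw [Set.uIcc_of_le hts.1]
      exact hFc.mono (Set.Icc_subset_Icc_right hts.2)
    have h2 := intervalIntegral.integral_hasDerivWithinAt_right (s := s) (t := s) h1
      (hFc.stronglyMeasurableAtFilter_nhdsWithin measurableSet_Icc t) (hFc t hts)
    have h3 := h2.const_mul (Real.sqrt c)
    exact h3.congr_of_mem (fun x _ => hφ x) hts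
  have hSS : ∀ t, S t = Sfr (U t) (W t) := hS
  have hS' : ∀ t ∈ s, HasDerivWithinAt S (S t * Mskew (V t) -
      (Real.sqrt c * ((c - ⟪C, W t⟫) / ‖U t‖ ^ 2)) • (Jmat * S t)) s t := by
    intro t hts
    rw [funext hSS]
    refine hasDeriv_S hr hts hWr (hD2 t hts) (hU' t hts) (hUe t hts) (hV3 t hts) ?_
    have h1 : c - ⟪C, W t⟫ = - ⟪A t, U t⟫ := by
      have h2 : C = W t - cross (A t) (V t) := by rw [hLQ t hts]; simp
      rw [← hWc t hts, h2, hUe t hts, inner_E3, inner_E3, normsq_E3]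
      simp only [cross_0, cross_1, cross_2, PiLp.sub_apply]
      ring
    rw [h1]; ring
  have hymem : ∀ t ∈ s, y t ∈ Matrix.specialOrthogonalGroup (Fin 3) ℝ := by
    intro t hts
    rw [hy, hSS]
    exact mul_mem (R_mem _) (S_mem (hV3 t hts) (hV2 t hts) (hWU t hts))
  have hy' : ∀ t ∈ s, HasDerivWithinAt y (y t * Mskew (V t)) s t := by
    intro t hts
    have h1 := hasDeriv_mat_mul (hasDeriv_R (hφ' t hts)) (hS' t hts)
    rw [funext hy]
    refine h1.congr_deriv ?_
    simp only [Matrix.mul_sub, Matrix.smul_mul, Matrix.mul_smul, Matrix.mul_assoc]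
    abel
  have hyy : ∀ t ∈ s, (y t)ᵀ * y t = 1 := fun t hts =>
    (Matrix.mem_orthogonalGroup_iff' _ _).1 (Matrix.mem_specialOrthogonalGroup_iff.1 (hymem t hts)).1
  refine ⟨fun t hts => ⟨hymem t hts, hy' t hts⟩, fun x₀ _ => ⟨?_, ?_, ?_⟩⟩
  · intro t hts
    refine (hasDeriv_mat_mul (hasDerivWithinAt_const t s (x₀ * (y t0)ᵀ))
      (hy' t hts)).congr_deriv ?_
    simp [Matrix.mul_assoc]
  · rw [Matrix.mul_assoc, hyy t0 ht0, Matrix.mul_one]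
  · intro z hz0 hz t hts
    have h1 : ∀ x ∈ s, HasDerivWithinAt (fun x => z x * (y x)ᵀ) 0 s x := by
      intro x hx
      refine (hasDeriv_mat_mul (hz x hx) (hasDeriv_mat_transpose (hy' x hx))).congr_deriv ?_
      rw [Matrix.transpose_mul, Mskew_transpose]
      simp [Matrix.mul_assoc]
    have h2 : z t * (y t)ᵀ = z t0 * (y t0)ᵀ :=
      constant_of_derivWithin_zero (f := fun x => z x * (y x)ᵀ)
        (fun x hx => (h1 x hx).differentiableWithinAt)
        (fun x hx => (h1 x (Set.Ico_subset_Icc_self hx)).derivWithin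
          (hu x (Set.Ico_subset_Icc_self hx))) t hts
    rw [← hz0, ← h2, Matrix.mul_assoc, hyy t hts, Matrix.mul_one]
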